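/- Let F = FreeGroup X be a free group on an infinite type X. Then the group Aut F is complete: the center of Aut F is trivial, and every automorphism of the group Aut F is inner (i.e. for every group automorphism Φ of Aut F there exists ψ ∈ Aut F with Φ(φ) = ψ ∘ φ ∘ ψ⁻¹ for all φ ∈ Aut F). -/

import Mathlib

namespace FreeGroup

variable {α : Type*}

theorem IsReduced.append_of_ne {A B : List (α × Bool)} (hA : IsReduced A) (hB : IsReduced B)
    (h : ∀ a ∈ A.getLast?, ∀ b ∈ B.head?, a.1 ≠ b.1) : IsReduced (A ++ B) :=
  List.isChain_append.2 ⟨hA, hB, fun a ha b hb e => absurd e (h a ha b hb)⟩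

theorem IsReduced.cons_of_ne {a : α × Bool} {B : List (α × Bool)} (hB : IsReduced B)
    (h : ∀ b ∈ B.head?, a.1 ≠ b.1) : IsReduced (a :: B) :=
  List.isChain_cons.2 ⟨fun b hb e => absurd e (h b hb), hB⟩

theorem IsReduced.toWord_mk [DecidableEq α] {L : List (α × Bool)} (h : IsReduced L) :
    (mk L).toWord = L := by
  rw [FreeGroup.toWord_mk, h.reduce_eq]

/-- An endomorphism fixing every generator occurring in a word fixes the element it represents. -/
theorem map_mk_eq_self (f : FreeGroup α →* FreeGroup α) {L : List (α × Bool)}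
    (h : ∀ c ∈ L, f (of c.1) = of c.1) : f (mk L) = mk L := by
  induction L with
  | nil => exact _root_.map_one f
  | cons c L ih =>
    have hc : f (mk [c]) = mk [c] := by
      obtain ⟨x, e⟩ := c
      have hx : f (of x) = of x := h (x, e) (by simp)
      cases e
      · rw [show mk [(x, false)] = (of x)⁻¹ from rfl, _root_.map_inv, hx]
      · exact hx
    rw [show mk (c :: L) = mk [c] * mk L by simp, _root_.map_mul, hc,
      ih fun d hd => h d (List.mem_cons_of_mem _ hd)]

/-- The set of generators occurring in the reduced word of `w`. -/
def letters [DecidableEq α] (w : FreeGroup α) : Finset α :=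
  (w.toWord.map Prod.fst).toFinset

theorem fst_mem_letters [DecidableEq α] {w : FreeGroup α} {c : α × Bool} (h : c ∈ w.toWord) :
    c.1 ∈ w.letters :=
  List.mem_toFinset.2 (List.mem_map_of_mem h)

theorem map_eq_self_of_letters [DecidableEq α] (f : FreeGroup α →* FreeGroup α) {w : FreeGroup α}
    (h : ∀ x ∈ w.letters, f (of x) = of x) : f w = w := by
  rw [← mk_toWord (x := w)]
  exact map_mk_eq_self f fun c hc => h _ (fst_mem_letters hc)

/-- A nontrivial element commuting with a generator has a reduced word starting with it. -/
theorem fst_eq_of_commute_of [DecidableEq α] {w : FreeGroup α} {a : α} (h : Commute w (of a))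
    {c : α × Bool} (hc : c ∈ w.toWord.head?) : c.1 = a := by
  by_contra hne
  obtain ⟨L, hL⟩ : ∃ L, w.toWord = c :: L := ⟨_, List.eq_cons_of_mem_head? hc⟩
  have hr : IsReduced ((a, true) :: w.toWord) :=
    isReduced_toWord.cons_of_ne (by grind)
  have h₁ : (of a * w).toWord = (a, true) :: w.toWord := by
    rw [toWord_mul, toWord_of]; exact hr.reduce_eq
  have h₂ := toWord_mul_sublist w (of a)
  rw [h.eq, h₁, toWord_of] at h₂
  have h₃ := h₂.eq_of_length (by simp)
  grind

theorem eq_one_of_commute_of_of {w : FreeGroup α} {a b : α} (hab : a ≠ b)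
    (ha : Commute w (of a)) (hb : Commute w (of b)) : w = 1 := by
  classical
  by_contra hw
  obtain ⟨c, hc⟩ : ∃ c, c ∈ w.toWord.head? := by
    have := mt toWord_eq_nil_iff.1 hw
    exact ⟨_, List.head_mem_head? this⟩
  exact hab ((fst_eq_of_commute_of ha hc).symm.trans (fst_eq_of_commute_of hb hc))

theorem commute_of_subsingleton [Subsingleton α] (u v : FreeGroup α) : Commute u v := by
  have h (a : α) (v : FreeGroup α) : Commute (of a) v := by
    induction v using FreeGroup.induction_on with
    | C1 => exact Commute.one_right _
    | of b => rw [Subsingleton.elim a b]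
    | inv_of b h => exact h.inv_right
    | mul x y hx hy => exact hx.mul_right hy
  induction u using FreeGroup.induction_on with
  | C1 => exact Commute.one_left _
  | of b => exact h b v
  | inv_of b h => exact h.inv_left
  | mul x y hx hy => exact hx.mul_left hy

/-- Commutation is transitive on nontrivial elements of a free group. -/
theorem commute_of_commute_of_commute {k x y : FreeGroup α} (hk : k ≠ 1) (hx : Commute k x)
    (hy : Commute k y) : Commute x y := by
  let H := Subgroup.centralizer {k}
  let e := IsFreeGroup.toFreeGroup H
  have mem {u : FreeGroup α} (hu : Commute k u) : u ∈ H :=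
    Subgroup.mem_centralizer_singleton_iff.2 hu.symm.eq
  let k' : H := ⟨k, mem (Commute.refl k)⟩
  have hk' (u : H) : Commute k' u :=
    Subtype.ext (Subgroup.mem_centralizer_singleton_iff.1 u.2).symm
  have : Subsingleton (IsFreeGroup.Generators H) := by
    refine ⟨fun a b => by_contra fun hab => hk ?_⟩
    have hc (u : FreeGroup (IsFreeGroup.Generators H)) : Commute (e k') u := by
      simpa using (hk' (e.symm u)).map e
    have : e k' = 1 := eq_one_of_commute_of_of hab (hc _) (hc _)
    exact congrArg Subtype.val (e.map_eq_one_iff.1 this)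
  have h := (commute_of_subsingleton (e ⟨x, mem hx⟩) (e ⟨y, mem hy⟩)).map e.symm
  simp only [MulEquiv.symm_apply_apply] at h
  exact congrArg Subtype.val h.eq

/-- A nontrivial element does not commute with its conjugate by a generator foreign to it. -/
theorem not_commute_conj_of [DecidableEq α] {k : FreeGroup α} (hk : k ≠ 1) {z : α}
    (hz : z ∉ k.letters) : ¬ Commute k (of z * k * (of z)⁻¹) := by
  intro h
  have hK {c : α × Bool} (hc : c ∈ k.toWord) : c.1 ≠ z :=
    fun e => hz (e ▸ fst_mem_letters hc)
  obtain ⟨c, L, hL⟩ := List.exists_cons_of_ne_nil (mt toWord_eq_nil_iff.1 hk)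
  have h₁ : IsReduced (k.toWord ++ [(z, false)]) :=
    isReduced_toWord.append_of_ne .singleton (by grind)
  have h₂ : IsReduced ((z, true) :: (k.toWord ++ [(z, false)])) :=
    h₁.cons_of_ne (by grind)
  have h₃ := isReduced_toWord.append_of_ne h₂ (A := k.toWord) (by grind)
  have h₄ := h₂.append_of_ne (isReduced_toWord (x := k)) (by grind)
  have e : of z * k * (of z)⁻¹ = mk ((z, true) :: (k.toWord ++ [(z, false)])) := by
    conv_lhs => rw [← mk_toWord (x := k)]
    rw [of, inv_mk, mul_mk, mul_mk]
    simp [invRev]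
  have := h.eq
  rw [e] at this
  nth_rw 1 4 [← mk_toWord (x := k)] at this
  rw [mul_mk, mul_mk] at this
  have := congrArg toWord this
  rw [h₃.toWord_mk, h₄.toWord_mk] at this
  grind

/-- The automorphism sending the generator `z` to `z * t` and fixing the other generators. -/
def transvection [DecidableEq α] (z t : α) (h : t ≠ z) : MulAut (FreeGroup α) :=
  MonoidHom.toMulEquiv (lift fun x => if x = z then of z * of t else of x)
    (lift fun x => if x = z then of z * (of t)⁻¹ else of x)
    (by ext x; by_cases hx : x = z <;> simp [hx, h])
    (by ext x; by_cases hx : x = z <;> simp [hx, h])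

theorem transvection_of_self [DecidableEq α] {z t : α} (h : t ≠ z) :
    transvection z t h (of z) = of z * of t := by
  simp [transvection]

theorem transvection_of_ne [DecidableEq α] {z t x : α} (h : t ≠ z) (hx : x ≠ z) :
    transvection z t h (of x) = of x := by
  simp [transvection, hx]

/-- The letterwise substitution `z ↦ z * t` on words. -/
def transvectionWord [DecidableEq α] (z t : α) (L : List (α × Bool)) : List (α × Bool) :=
  L.flatMap fun c =>
    if c.1 = z then if c.2 then [(z, true), (t, true)] else [(t, false), (z, false)] else [c]

theorem transvection_mk [DecidableEq α] {z t : α} (h : t ≠ z) (L : List (α × Bool)) :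
    transvection z t h (mk L) = mk (transvectionWord z t L) := by
  induction L with
  | nil => exact _root_.map_one (transvection z t h)
  | cons c L ih =>
    have hc : transvection z t h (mk [c]) = mk (transvectionWord z t [c]) := by
      obtain ⟨x, e⟩ := c
      have hx : transvection z t h (of x) = if x = z then of z * of t else of x := by
        split_ifs with hx
        · rw [hx, transvection_of_self]
        · exact transvection_of_ne h hx
      cases e
      · rw [show mk [(x, false)] = (of x)⁻¹ from rfl, _root_.map_inv, hx]
        split_ifs with hx <;> simp [transvectionWord, hx, of, invRev]
      · rw [show mk [(x, true)] = of x from rfl, hx]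
        split_ifs with hx <;> simp [transvectionWord, hx, of]
    rw [show mk (c :: L) = mk [c] * mk L by simp, _root_.map_mul, hc, ih, mul_mk]
    simp [transvectionWord]

theorem IsReduced.transvectionWord [DecidableEq α] {z t : α} (h : t ≠ z) {L : List (α × Bool)}
    (hL : IsReduced L) (ht : ∀ c ∈ L, c.1 ≠ t) : IsReduced (transvectionWord z t L) := by
  induction L with
  | nil => exact .nil
  | cons c L ih =>
    have hcL := List.isChain_cons.1 hL
    have ih := ih hcL.2 fun d hd => ht d (List.mem_cons_of_mem _ hd)
    obtain ⟨x, e⟩ := c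
    cases L with
    | nil =>
      by_cases hx : x = z <;> cases e <;>
        simp [FreeGroup.transvectionWord, hx, IsReduced, h, h.symm]
    | cons d L =>
      obtain ⟨y, e'⟩ := d
      have hxt : x ≠ t := ht (x, e) (by simp)
      have hyt : y ≠ t := ht (y, e') (by simp)
      have hxy : x = y → e = e' := hcL.1 (y, e') (by simp)
      by_cases hx : x = z <;> by_cases hy : y = z <;> cases e <;> cases e' <;>
        simp_all [FreeGroup.transvectionWord, IsReduced, List.isChain_cons_cons, Ne.symm]

/-- The automorphism exchanging two generators. -/
def swapGenerators [DecidableEq α] (z w : α) : MulAut (FreeGroup α) :=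
  freeGroupCongr (Equiv.swap z w)

theorem swapGenerators_of [DecidableEq α] (z w x : α) :
    swapGenerators z w (of x) = of (Equiv.swap z w x) :=
  map.of

theorem swapGenerators_mk [DecidableEq α] (z w : α) (L : List (α × Bool)) :
    swapGenerators z w (mk L) = mk (L.map fun c => (Equiv.swap z w c.1, c.2)) :=
  map.mk

theorem eq_of_of_transvection_eq_mul_swap [DecidableEq α] {v : FreeGroup α} {z w : α}
    (h : w ≠ z) (hw : w ∉ v.letters) {e : Bool} {q : List (α × Bool)}
    (hv : v.toWord = (z, e) :: q) (hb : transvection z w h v = v * swapGenerators z w v) :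
    v = of z := by
  have hne {c : α × Bool} (hc : c ∈ v.toWord) : c.1 ≠ w :=
    fun e => hw (e ▸ fst_mem_letters hc)
  have hred := isReduced_toWord (x := v)
  have hσ : IsReduced (v.toWord.map fun c => (Equiv.swap z w c.1, c.2)) :=
    (List.isChain_map _).2 (hred.imp fun a b hab e => hab ((Equiv.swap z w).injective e))
  have h₁ := hred.append_of_ne hσ <| by
    simp only [hv, List.map_cons, List.head?_cons, Option.mem_some_iff, Equiv.swap_apply_left]
    rintro a ha _ rfl
    exact hne (hv ▸ List.mem_of_mem_getLast? ha)
  have h₂ := hred.transvectionWord h fun c hc => hne hc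
  rw [← mk_toWord (x := v), transvection_mk, swapGenerators_mk, mul_mk] at hb
  have hb := congrArg toWord hb
  rw [h₁.toWord_mk, h₂.toWord_mk, hv] at hb
  have hq : ∀ c ∈ q, c.1 ≠ w := fun c hc => hne (hv ▸ List.mem_cons_of_mem _ hc)
  have : e = true ∧ q = [] := by
    cases e
    · simp [transvectionWord, h] at hb
    · cases q with
      | nil => exact ⟨rfl, rfl⟩
      | cons d q =>
        simp only [transvectionWord, List.flatMap_cons, if_true, List.cons_append,
          List.cons.injEq] at hb
        exact absurd (congrArg Prod.fst hb.2.1).symm (hq d (by simp))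
  rw [← toWord_inj, hv, toWord_of, this.1, this.2]

theorem exists_append_cons_of_exists_mem {β : Type*} {P : β → Prop} {L : List β}
    (h : ∃ x ∈ L, P x) : ∃ A a B, L = A ++ a :: B ∧ P a ∧ ∀ x ∈ A, ¬ P x := by
  induction L with
  | nil => simp at h
  | cons c L ih =>
    by_cases hc : P c
    · exact ⟨[], c, L, rfl, hc, by simp⟩
    · obtain ⟨A, a, B, rfl, ha, hA⟩ := ih (by grind)
      exact ⟨c :: A, a, B, rfl, ha, by grind⟩

/-- An element involving the generator `z` has a conjugate whose reduced word starts with `z` or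
`z⁻¹`, by a conjugator free of `z`. -/
theorem exists_conj_toWord_eq_cons [DecidableEq α] {v : FreeGroup α} {z w : α}
    (hz : z ∈ v.letters) (hw : w ∉ v.letters) :
    ∃ p : FreeGroup α, z ∉ p.letters ∧ w ∉ p.letters ∧ w ∉ (p⁻¹ * v * p).letters ∧
      ∃ e q, (p⁻¹ * v * p).toWord = (z, e) :: q := by
  have hne {c : α × Bool} (hc : c ∈ v.toWord) : c.1 ≠ w :=
    fun e => hw (e ▸ fst_mem_letters hc)
  obtain ⟨P, ⟨x, e⟩, Q, hPQ, rfl, hP⟩ :=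
    exists_append_cons_of_exists_mem (P := fun c : α × Bool => c.1 = z) (L := v.toWord)
      (by simpa [letters] using hz)
  obtain ⟨R', a, M', hM, ha, hR'⟩ :=
    exists_append_cons_of_exists_mem (P := fun c : α × Bool => c.1 = x)
      (L := ((x, e) :: Q).reverse) ⟨(x, e), by simp, rfl⟩
  obtain ⟨N, hN⟩ : ∃ N, (a :: M').reverse = (x, e) :: N := by
    have hM' := congrArg List.reverse hM
    rw [List.reverse_reverse, List.reverse_append] at hM'
    obtain ⟨b, N, hN⟩ := List.exists_cons_of_ne_nil (l := (a :: M').reverse) (by simp)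
    rw [hN, List.cons_append, List.cons.injEq] at hM'
    exact ⟨N, hM'.1 ▸ hN⟩
  have hQ : (x, e) :: Q = (x, e) :: N ++ R'.reverse := by
    rw [← hN, ← List.reverse_append, ← hM, List.reverse_reverse]
  have hred := isReduced_toWord (x := v)
  rw [hPQ] at hred
  have hPred : IsReduced P := hred.infix ⟨[], (x, e) :: Q, by simp⟩
  have hword : (mk P)⁻¹ * v * mk P = mk ((x, e) :: N ++ reduce (R'.reverse ++ P)) := by
    rw [← mk_toWord (x := v), hPQ, hQ, ← mul_mk, ← mul_mk, ← mul_mk, reduce.self, ← mul_mk]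
    group
  have hsub {c : α × Bool} (hc : c ∈ reduce (R'.reverse ++ P)) : c ∈ R' ∨ c ∈ P := by
    simpa using reduce.red.sublist.subset hc
  have hwred : IsReduced ((x, e) :: N ++ reduce (R'.reverse ++ P)) := by
    refine IsReduced.append_of_ne ?_ (isReduced_iff_reduce_eq.2 reduce.idem) ?_
    · exact hred.infix ⟨P, R'.reverse, by simp [hQ]⟩
    · intro c hc d hd
      have hca : c = a := by
        rw [← hN, List.getLast?_reverse] at hc
        simpa using hc.symm
      rw [hca, ha]
      rcases hsub (List.mem_of_mem_head? hd) with h | h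
      · exact Ne.symm (hR' d h)
      · exact Ne.symm (hP d h)
  have hmemQ {c : α × Bool} (hc : c ∈ P ∨ c ∈ (x, e) :: Q) : c.1 ≠ w :=
    hne (hPQ ▸ List.mem_append.2 hc)
  have hmem {c : α × Bool} (hc : c ∈ (x, e) :: N ++ reduce (R'.reverse ++ P)) : c.1 ≠ w := by
    rcases List.mem_append.1 hc with hc | hc
    · exact hmemQ (.inr (hQ ▸ List.mem_append_left _ hc))
    · refine hmemQ ((hsub hc).symm.imp_right fun hc => ?_)
      exact hQ ▸ List.mem_append_right _ (List.mem_reverse.2 hc)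
  refine ⟨mk P, ?_, ?_, ?_, e, N ++ reduce (R'.reverse ++ P), ?_⟩
  · simp only [letters, hPred.toWord_mk, List.mem_toFinset, List.mem_map, not_exists, not_and]
    exact hP
  · simp only [letters, hPred.toWord_mk, List.mem_toFinset, List.mem_map, not_exists, not_and]
    exact fun c hc => hmemQ (.inl hc)
  · simp only [letters, hword, hwred.toWord_mk, List.mem_toFinset, List.mem_map, not_exists,
      not_and]
    exact fun c hc => hmem hc
  · rw [hword, hwred.toWord_mk]; rfl

theorem exists_eq_conj_of_transvection_eq_mul_swap [DecidableEq α] {v : FreeGroup α} (hv : v ≠ 1)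
    {z w : α} (h : w ≠ z) (hw : w ∉ v.letters)
    (hb : transvection z w h v = v * swapGenerators z w v) :
    ∃ p : FreeGroup α, z ∉ p.letters ∧ w ∉ p.letters ∧ v = p * of z * p⁻¹ := by
  have fixT {u : FreeGroup α} (hz : z ∉ u.letters) : transvection z w h u = u :=
    map_eq_self_of_letters (transvection z w h).toMonoidHom fun x hx =>
      transvection_of_ne h (ne_of_mem_of_not_mem hx hz)
  have fixS {u : FreeGroup α} (hz : z ∉ u.letters) (hw : w ∉ u.letters) :
      swapGenerators z w u = u :=
    map_eq_self_of_letters (swapGenerators z w).toMonoidHom fun x hx =>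
      (swapGenerators_of z w x).trans <| congrArg of <|
        Equiv.swap_apply_of_ne_of_ne (ne_of_mem_of_not_mem hx hz) (ne_of_mem_of_not_mem hx hw)
  by_cases hz : z ∈ v.letters
  · obtain ⟨p, hzp, hwp, hwv, e, q, hq⟩ := exists_conj_toWord_eq_cons hz hw
    refine ⟨p, hzp, hwp, ?_⟩
    have := eq_of_of_transvection_eq_mul_swap h hwv hq (by
      simp only [_root_.map_mul, _root_.map_inv, fixT hzp, fixS hzp hwp, hb]
      group)
    rw [← this]
    group
  · rw [fixT hz, fixS hz hw, left_eq_mul] at hb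
    exact absurd hb hv

/-- An automorphism commuting with all automorphisms that fix finitely many given generators is
inner. -/
theorem exists_eq_conj_of_commute [Infinite α] (φ : MulAut (FreeGroup α)) (Y : Finset α)
    (hφ : ∀ b : MulAut (FreeGroup α), (∀ y ∈ Y, b (of y) = of y) → Commute φ b) :
    ∃ g, φ = MulAut.conj g := by
  classical
  have comm {b : MulAut (FreeGroup α)} (hb : ∀ y ∈ Y, b (of y) = of y) (u : FreeGroup α) :
      b (φ u) = φ (b u) := (DFunLike.congr_fun (hφ b hb).eq u).symm
  obtain ⟨z, hz⟩ := Infinite.exists_notMem_finset Y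
  obtain ⟨w, hw⟩ := Infinite.exists_notMem_finset (insert z (Y ∪ (φ (of z)).letters))
  simp only [Finset.mem_insert, Finset.mem_union, not_or] at hw
  obtain ⟨hwz, hwY, hwv⟩ := hw
  have commT {t : α} (ht : t ≠ z) : transvection z t ht (φ (of z)) = φ (of z) * φ (of t) := by
    rw [comm fun y hy => transvection_of_ne ht (ne_of_mem_of_not_mem hy hz),
      transvection_of_self, _root_.map_mul]
  have commS : swapGenerators z w (φ (of z)) = φ (of w) := by
    rw [comm, swapGenerators_of, Equiv.swap_apply_left]
    intro y hy
    rw [swapGenerators_of, Equiv.swap_apply_of_ne_of_ne (ne_of_mem_of_not_mem hy hz)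
      (ne_of_mem_of_not_mem hy hwY)]
  obtain ⟨p, hzp, -, hp⟩ := exists_eq_conj_of_transvection_eq_mul_swap
    (mt (EmbeddingLike.map_eq_one_iff (f := φ)).1 (of_ne_one z)) hwz hwv
    ((commT hwz).trans (by rw [commS]))
  refine ⟨p, MulEquiv.toMonoidHom_injective (FreeGroup.ext_hom _ _ fun t => ?_)⟩
  change φ (of t) = p * of t * p⁻¹
  by_cases ht : t = z
  · rw [ht, hp]
  · have fixT : transvection z t ht p = p :=
      map_eq_self_of_letters (transvection z t ht).toMonoidHom fun x hx =>
        transvection_of_ne ht (ne_of_mem_of_not_mem hx hzp)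
    have := commT ht
    rw [hp] at this
    simp only [_root_.map_mul, _root_.map_inv, fixT, transvection_of_self] at this
    rw [← mul_right_inj (p * of z * p⁻¹), ← this]
    group

theorem conj_injective [Nontrivial α] :
    Function.Injective (MulAut.conj : FreeGroup α →* MulAut (FreeGroup α)) := by
  refine (injective_iff_map_eq_one _).2 fun g hg => ?_
  obtain ⟨a, b, hab⟩ := exists_pair_ne α
  have (u : FreeGroup α) : Commute g u := by
    have := DFunLike.congr_fun hg u
    exact mul_inv_eq_iff_eq_mul.1 this
  exact eq_one_of_commute_of_of hab (this _) (this _)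

theorem mul_conj_mul_inv {G : Type*} [Group G] (φ : MulAut G) (g : G) :
    φ * MulAut.conj g * φ⁻¹ = MulAut.conj (φ g) := by
  ext u
  simp

theorem center_mulAut_eq_bot [Nontrivial α] : Subgroup.center (MulAut (FreeGroup α)) = ⊥ := by
  refine (Subgroup.eq_bot_iff_forall _).2 fun φ hφ => MulEquiv.ext fun u => ?_
  apply conj_injective
  rw [← mul_conj_mul_inv, mul_inv_eq_iff_eq_mul]
  exact (Subgroup.mem_center_iff.1 hφ _).symm

/-- Every automorphism of `Aut F` maps inner automorphisms of `F` to inner automorphisms. -/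
theorem exists_map_conj_eq_conj [Infinite α] (Φ : MulAut (MulAut (FreeGroup α)))
    (h : FreeGroup α) : ∃ g, Φ (MulAut.conj h) = MulAut.conj g := by
  classical
  -- The image of the inner automorphism group is normal.
  have normal (b : MulAut (FreeGroup α)) (m : FreeGroup α) :
      b * Φ (MulAut.conj m) * b⁻¹ = Φ (MulAut.conj (Φ.symm b m)) := by
    rw [← mul_conj_mul_inv]
    simp
  set φ := Φ (MulAut.conj h) with hφ
  by_cases h₁ : φ = 1
  · exact ⟨1, by rw [h₁, _root_.map_one]⟩
  obtain ⟨x, hx⟩ : ∃ x, φ x ≠ x := by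
    by_contra! hx
    exact h₁ (MulEquiv.ext hx)
  -- The nontrivial inner automorphism `[φ, conj x]` lies in this image.
  have comm (b : MulAut (FreeGroup α)) :
      φ * b * φ⁻¹ * b⁻¹ = Φ (MulAut.conj (h * (Φ.symm b h)⁻¹)) := by
    rw [_root_.map_mul, _root_.map_mul, _root_.map_inv, _root_.map_inv, ← normal b h, ← hφ]
    group
  obtain ⟨k, hk, m, hm⟩ : ∃ k : FreeGroup α, k ≠ 1 ∧ ∃ m, Φ (MulAut.conj m) = MulAut.conj k := by
    refine ⟨φ x * x⁻¹, mul_inv_eq_one.not.2 hx, _, (comm (MulAut.conj x)).symm.trans ?_⟩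
    rw [mul_conj_mul_inv, _root_.map_mul, _root_.map_inv]
  obtain ⟨z, hz⟩ := Infinite.exists_notMem_finset k.letters
  set k' := of z * k * (of z)⁻¹ with hk'
  obtain ⟨m', hm'⟩ : ∃ m', Φ (MulAut.conj m') = MulAut.conj k' :=
    ⟨_, (normal (MulAut.conj (of z)) m).symm.trans (by rw [hm, mul_conj_mul_inv]; rfl)⟩
  have hkk' : ¬ Commute m m' := fun hmm => not_commute_conj_of hk hz <| by
    have := (hmm.map MulAut.conj).map Φ
    rw [hm, hm', ← hk'] at *
    exact conj_injective (by simpa only [_root_.map_mul] using this.eq)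
  refine exists_eq_conj_of_commute φ
    (k.letters ∪ (φ⁻¹ k).letters ∪ k'.letters ∪ (φ⁻¹ k').letters) fun b hb => ?_
  have fix {u : FreeGroup α} (hu : u.letters ⊆
      k.letters ∪ (φ⁻¹ k).letters ∪ k'.letters ∪ (φ⁻¹ k').letters) : b u = u :=
    map_eq_self_of_letters b.toMonoidHom fun x hx => hb x (hu hx)
  obtain ⟨n, hn⟩ : ∃ n, φ * b * φ⁻¹ * b⁻¹ = Φ (MulAut.conj n) := ⟨_, comm b⟩
  have commute_n {u i : FreeGroup α} (hi : Φ (MulAut.conj i) = MulAut.conj u) (hbu : b u = u)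
      (hbu' : b (φ⁻¹ u) = φ⁻¹ u) : Commute n i := by
    apply conj_injective
    apply Φ.injective
    have : (φ * b * φ⁻¹ * b⁻¹) u = u := by
      have : b⁻¹ u = u := by rw [MulAut.inv_apply, MulEquiv.symm_apply_eq, hbu]
      simp only [MulAut.mul_apply, this, hbu']
      simp
    rw [_root_.map_mul, _root_.map_mul, _root_.map_mul, _root_.map_mul, hi, ← hn,
      ← mul_inv_eq_iff_eq_mul, mul_conj_mul_inv, this]
  have hn1 : n = 1 := by
    by_contra hn1
    refine hkk' (commute_of_commute_of_commute hn1 (commute_n hm ?_ ?_) (commute_n hm' ?_ ?_)) <;>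
      exact fix fun y hy => by simp only [Finset.mem_union]; tauto
  rw [hn1, _root_.map_one, _root_.map_one, mul_inv_eq_one, mul_inv_eq_iff_eq_mul] at hn
  exact hn

end FreeGroup

/-- The automorphism group of a free group of infinite rank is complete: its center is
trivial and each of its automorphisms is inner. -/
theorem aut_free_group_complete {X : Type*} [Infinite X] :
    Subgroup.center (MulAut (FreeGroup X)) = ⊥ ∧
    ∀ Φ : MulAut (MulAut (FreeGroup X)), ∃ ψ : MulAut (FreeGroup X),
      ∀ φ : MulAut (FreeGroup X), Φ φ = ψ * φ * ψ⁻¹ := by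
  refine ⟨FreeGroup.center_mulAut_eq_bot, fun Φ => ?_⟩
  have inj := FreeGroup.conj_injective (α := X)
  choose f hf using FreeGroup.exists_map_conj_eq_conj Φ
  choose f' hf' using FreeGroup.exists_map_conj_eq_conj Φ.symm
  let ψ : MulAut (FreeGroup X) :=
    { toFun := f
      invFun := f'
      left_inv := fun g => inj (by rw [← hf', ← hf]; simp)
      right_inv := fun g => inj (by rw [← hf, ← hf']; simp)
      map_mul' := fun g h => inj (by rw [map_mul, ← hf, ← hf, ← hf, map_mul, map_mul]) }
  have hψ (g : FreeGroup X) : Φ (MulAut.conj g) = MulAut.conj (ψ g) := hf g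
  refine ⟨ψ, fun φ => eq_mul_inv_of_mul_eq (MulEquiv.ext fun g => inj ?_)⟩
  change MulAut.conj (Φ φ (ψ g)) = MulAut.conj (ψ (φ g))
  rw [← hψ, ← FreeGroup.mul_conj_mul_inv φ, map_mul, map_mul, map_inv, hψ,
    FreeGroup.mul_conj_mul_inv]
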